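/- arXiv:1701.00346 — 2 statements merged into one kernel-verified Lean document; each statement's English description precedes it below -/
import Mathlib

section
/- Let t > 1 and κ > 1 be real numbers, s ≥ 1 an integer, let n ≥ 1 and 1 ≤ n1 ≤ n be integers, set λ_{N'} := M_{n1,n1−2N'}(t) · M_{2n−n1,n1−2N'}(t) / M_{2n,0}(t) for 0 ≤ N' ≤ ⌊n1/2⌋, and define the Rényi entropy S^κ_{n1}(s,t) := (1/(1−κ)) · log[ Σ_{N'=0}^{⌊n1/2⌋} s^{(1−κ)(n1−2N')} λ_{N'}^κ ]. Then n1 log s + (4κ/(1−2κ)) log C(t) + (1/(1−2κ)) log D4(s,t,2κ) < S^κ_{n1}(s,t) < n1 log s + D2(t) + D3(t), where D2(t) := log[Σ_{M'=0}^∞ t^{−2M'²}], D3(t) := 2 C(t)² log t · Σ_{N'=0}^∞ N'² t^{−2N'²}, and D4(s,t,κ) := Σ_{N'=0}^∞ s^{−2(1−κ)N'} t^{−2κN'²}. -/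
noncomputable section

open Finset

/-- Height of the path `w` (of length `L`, up = `true`, down = `false`) after `i` steps. -/
def height {L : ℕ} (w : Fin L → Bool) (i : ℕ) : ℤ :=
  ∑ j ∈ Finset.univ.filter (fun j : Fin L => (j : ℕ) < i),
    (if w j then (1 : ℤ) else -1)

/-- `DyckSet a b`: the set `D_{a,b}` of paths of length `2a+b` with `a+b` up steps whose
heights stay nonnegative. -/
def DyckSet (a b : ℕ) : Finset (Fin (2 * a + b) → Bool) :=
  Finset.univ.filter (fun w =>
    (Finset.univ.filter (fun j => w j = true)).card = a + b ∧
      ∀ i ≤ 2 * a + b, 0 ≤ height w i)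

/-- The area `A(w)` between the path `w` and the x-axis. -/
def area {L : ℕ} (w : Fin L → Bool) : ℝ :=
  (∑ i ∈ Finset.range L, ((height w i + height w (i + 1) : ℤ) : ℝ)) / 2

/-- The weighted path sum `M_{2a+b,b}(t) = Σ_{w ∈ D_{a,b}} t^{A(w)}`. -/
def M (a b : ℕ) (t : ℝ) : ℝ := ∑ w ∈ DyckSet a b, t ^ area w

/-- `M_{ℓ,m}(t)` for `ℓ ≥ m` with `ℓ - m` even. -/
def Mlm (ℓ m : ℕ) (t : ℝ) : ℝ := M ((ℓ - m) / 2) m t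

/-- `P k`: the number of partitions of `k`. -/
def P (k : ℕ) : ℕ := Fintype.card (Nat.Partition k)

/-- `C(t) = Σ_{k=0}^∞ P(k) t^{-2k}`. -/
def C (t : ℝ) : ℝ := ∑' k : ℕ, (P k : ℝ) * t ^ (-(2 : ℝ) * k)

/-! ### Partitions with bounded parts -/

open Nat.Partition in
lemma card_restricted_le_zero (k : ℕ) :
    #(restricted k (· ≤ 0)) = if k = 0 then 1 else 0 := by
  split_ifs with hk
  · subst hk
    simp [restricted]
  · rw [card_eq_zero, restricted, filter_eq_empty_iff]
    intro p _ hp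
    apply hk
    rw [← p.parts_sum]
    exact Multiset.sum_eq_zero fun x hx => Nat.le_zero.mp (hp x hx)

open Nat.Partition in
lemma card_restricted_le_succ (a k : ℕ) :
    #(restricted k (· ≤ a + 1)) = #(restricted k (· ≤ a)) +
      if a + 1 ≤ k then #(restricted (k - (a + 1)) (· ≤ a + 1)) else 0 := by
  rw [← card_filter_add_card_filter_not (s := restricted k (· ≤ a + 1))
    (fun p => a + 1 ∉ p.parts)]
  congr 1
  · congr 1
    ext p
    simp only [restricted, mem_filter, mem_univ, true_and]
    constructor
    · rintro ⟨h, hn⟩ i hi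
      exact Nat.lt_succ_iff.mp (lt_of_le_of_ne (h i hi) fun e => hn (by rwa [e] at hi))
    · exact fun h => ⟨fun i hi => (h i hi).trans (Nat.le_succ a),
        fun hi => absurd (h _ hi) (by omega)⟩
  · split_ifs with hk
    · refine card_bij'
        (fun p hp => partitionWithPartEquiv (n := k) (a := a + 1) (by omega) hk
          ⟨p, by simpa using (mem_filter.mp hp).2⟩)
        (fun p _ => ((partitionWithPartEquiv (n := k) (a := a + 1) (by omega) hk).symm p).1)
        ?_ ?_ ?_ ?_
      · intro p hp
        simp only [restricted, mem_filter, mem_univ, true_and] at hp ⊢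
        intro i hi
        rw [partitionWithPartEquiv_apply_parts] at hi
        exact hp.1 i (Multiset.mem_of_mem_erase hi)
      · intro p hp
        simp only [restricted, mem_filter, mem_univ, true_and] at hp ⊢
        rw [partitionWithPartEquiv_symm_apply_parts]
        refine ⟨fun i hi => ?_, by simp⟩
        rcases Multiset.mem_cons.mp hi with rfl | hi
        · exact le_rfl
        · exact hp i hi
      · intro p hp
        simp
      · intro p hp
        simp
    · rw [card_eq_zero, filter_eq_empty_iff]
      intro p _ hp
      exact hk (p.le_of_mem_parts (by simpa using hp))

/-- The generating function `∏ 1 / (1 - q ^ i)`, `1 ≤ i ≤ a`, of partitions with parts at most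
`a`. -/
def boundedGen (q : ℝ) (a : ℕ) : ℝ := ∏ i ∈ range a, (1 - q ^ (i + 1))⁻¹

lemma boundedGen_succ {q : ℝ} (h0 : 0 < q) (h1 : q < 1) (a : ℕ) :
    boundedGen q (a + 1) = boundedGen q a + q ^ (a + 1) * boundedGen q (a + 1) := by
  have : q ^ (a + 1) < 1 := pow_lt_one₀ h0.le h1 (by omega)
  have h' : 1 - q ^ (a + 1) ≠ 0 := by linarith
  rw [boundedGen, prod_range_succ]
  unfold boundedGen
  field_simp
  ring

lemma boundedGen_pos {q : ℝ} (h0 : 0 < q) (h1 : q < 1) (a : ℕ) : 0 < boundedGen q a :=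
  prod_pos fun i _ => inv_pos.mpr (sub_pos.mpr (pow_lt_one₀ h0.le h1 (Nat.succ_ne_zero i)))

lemma boundedGen_le {q : ℝ} (h0 : 0 < q) (h1 : q < 1) (a : ℕ) :
    boundedGen q a ≤ Real.exp (((1 - q)⁻¹) ^ 2) := by
  have hq : 0 < 1 - q := by linarith
  calc boundedGen q a ≤ ∏ i ∈ range a, Real.exp ((1 - q)⁻¹ * q ^ i) := by
        refine prod_le_prod (fun i _ => ?_) fun i _ => ?_
        · exact inv_nonneg.mpr (sub_nonneg.mpr (pow_le_one₀ h0.le h1.le))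
        · have hlt : q ^ (i + 1) < 1 := pow_lt_one₀ h0.le h1 (Nat.succ_ne_zero i)
          have hle : q ^ (i + 1) ≤ q := pow_le_of_le_one h0.le h1.le (Nat.succ_ne_zero i)
          have hpos : 0 < 1 - q ^ (i + 1) := by linarith
          have e : (1 - q ^ (i + 1))⁻¹ = q ^ (i + 1) * (1 - q ^ (i + 1))⁻¹ + 1 := by
            field_simp; ring
          rw [e]
          refine le_trans ?_ (Real.add_one_le_exp _)
          gcongr ?_ + 1
          rw [mul_comm]
          have : q ^ (i + 1) ≤ q ^ i := pow_le_pow_of_le_one h0.le h1.le (Nat.le_succ i)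
          gcongr
    _ = Real.exp ((1 - q)⁻¹ * ∑ i ∈ range a, q ^ i) := by rw [← Real.exp_sum, mul_sum]
    _ ≤ Real.exp (((1 - q)⁻¹) ^ 2) := by
        rw [sq]
        gcongr
        rw [← tsum_geometric_of_lt_one h0.le h1]
        exact (summable_geometric_of_lt_one h0.le h1).sum_le_tsum _ fun i _ => by positivity

open Nat.Partition in
lemma hasSum_card_restricted_le {q : ℝ} (h0 : 0 < q) (h1 : q < 1) (a : ℕ) :
    HasSum (fun k => (#(restricted k (· ≤ a)) : ℝ) * q ^ k) (boundedGen q a) := by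
  induction a with
  | zero =>
    have := hasSum_ite_eq (0 : ℕ) (1 : ℝ)
    simp only [boundedGen, range_zero, prod_empty]
    convert this using 2 with k
    rw [card_restricted_le_zero]
    split_ifs with hk <;> simp [hk]
  | succ a ih =>
    set u : ℕ → ℝ := fun k => (#(restricted k (· ≤ a + 1)) : ℝ) * q ^ k with hu
    set v : ℕ → ℝ := fun k => (#(restricted k (· ≤ a)) : ℝ) * q ^ k with hv
    have hv0 : ∀ k, 0 ≤ v k := fun k => by positivity
    have hu0 : ∀ k, 0 ≤ u k := fun k => by positivity
    have hrec : ∀ k, u k = v k + if a + 1 ≤ k then q ^ (a + 1) * u (k - (a + 1)) else 0 := by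
      intro k
      simp only [hu, hv]
      rw [card_restricted_le_succ]
      split_ifs with hk
      · obtain ⟨j, rfl⟩ := Nat.exists_eq_add_of_le hk
        rw [Nat.add_sub_cancel_left]
        push_cast
        ring
      · simp
    clear_value u v
    have hlow : ∀ k < a + 1, u k = v k := fun k hk => by
      rw [hrec, if_neg (not_le.mpr hk), add_zero]
    have hhigh : ∀ j, u (j + (a + 1)) = v (j + (a + 1)) + q ^ (a + 1) * u j := fun j => by
      rw [hrec, if_pos (Nat.le_add_left _ _), Nat.add_sub_cancel]
    have hqa : q ^ (a + 1) < 1 := pow_lt_one₀ h0.le h1 (by omega)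
    have hpos : 0 < 1 - q ^ (a + 1) := by linarith
    have hbound : ∀ K, ∑ k ∈ range K, u k ≤ boundedGen q a / (1 - q ^ (a + 1)) := by
      intro K
      have hV : ∑ k ∈ range (a + 1 + K), v k ≤ boundedGen q a :=
        sum_le_hasSum _ (fun k _ => hv0 k) ih
      have hsplit : ∑ k ∈ range (a + 1 + K), u k =
          ∑ k ∈ range (a + 1 + K), v k + q ^ (a + 1) * ∑ k ∈ range K, u k := by
        rw [sum_range_add u (a + 1) K, sum_range_add v (a + 1) K, mul_sum, add_assoc, ← sum_add_distrib]
        congr 1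
        · exact sum_congr rfl fun k hk => hlow k (mem_range.mp hk)
        · refine sum_congr rfl fun k _ => ?_
          rw [add_comm (a + 1) k, hhigh]
      have hmono : ∑ k ∈ range K, u k ≤ ∑ k ∈ range (a + 1 + K), u k :=
        sum_le_sum_of_subset_of_nonneg (range_mono (by omega)) fun k _ _ => hu0 k
      rw [le_div_iff₀ hpos]
      nlinarith
    have hs : Summable u := summable_of_sum_range_le hu0 hbound
    have e1 := hs.sum_add_tsum_nat_add (a + 1)
    have e2 := ih.summable.sum_add_tsum_nat_add (a + 1)
    rw [ih.tsum_eq] at e2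
    have e3 : ∑' j, u (j + (a + 1)) = ∑' j, v (j + (a + 1)) + q ^ (a + 1) * ∑' j, u j := by
      simp_rw [hhigh]
      rw [Summable.tsum_add ((summable_nat_add_iff (a + 1)).mpr ih.summable)
        (hs.mul_left _), tsum_mul_left]
    have e4 : ∑ k ∈ range (a + 1), u k = ∑ k ∈ range (a + 1), v k :=
      sum_congr rfl fun k hk => hlow k (mem_range.mp hk)
    have e5 := boundedGen_succ h0 h1 a
    have : ∑' k, u k = boundedGen q (a + 1) := by
      have h3 : (1 - q ^ (a + 1)) * (∑' k, u k) = (1 - q ^ (a + 1)) * boundedGen q (a + 1) := by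
        have h6 : ∑ k ∈ range (a + 1), v k + ∑' j, v (j + (a + 1)) = boundedGen q a := e2
        linear_combination (-1 : ℝ) * e1 + e3 + e4 + h6 - e5
      exact mul_left_cancel₀ hpos.ne' h3
    rw [← this]
    exact hs.hasSum

lemma summable_card_partition_mul_pow {q : ℝ} (h0 : 0 < q) (h1 : q < 1) :
    Summable fun k => (P k : ℝ) * q ^ k := by
  refine summable_of_sum_range_le (c := Real.exp (((1 - q)⁻¹) ^ 2)) (fun k => by positivity)
    fun K => ?_
  calc ∑ k ∈ range K, (P k : ℝ) * q ^ k
      = ∑ k ∈ range K, (#(Nat.Partition.restricted k (· ≤ K)) : ℝ) * q ^ k := by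
        refine sum_congr rfl fun k hk => ?_
        rw [Nat.Partition.restricted, filter_true_of_mem, card_univ, P]
        exact fun p _ i hi => (p.le_of_mem_parts hi).trans (mem_range.mp hk).le
    _ ≤ boundedGen q K :=
        sum_le_hasSum _ (fun k _ => by positivity) (hasSum_card_restricted_le h0 h1 K)
    _ ≤ _ := boundedGen_le h0 h1 K

lemma boundedGen_le_tsum {q : ℝ} (h0 : 0 < q) (h1 : q < 1) (a : ℕ) :
    boundedGen q a ≤ ∑' k, (P k : ℝ) * q ^ k := by
  rw [← (hasSum_card_restricted_le h0 h1 a).tsum_eq]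
  refine Summable.tsum_le_tsum (fun k => ?_) (hasSum_card_restricted_le h0 h1 a).summable
    (summable_card_partition_mul_pow h0 h1)
  gcongr
  exact card_le_univ _

lemma C_eq {t : ℝ} (ht : 0 < t) : C t = ∑' k, (P k : ℝ) * (t ^ (-2 : ℝ)) ^ k := by
  simp_rw [C, Real.rpow_mul_natCast ht.le]

/-! ### Weighted sums of nonnegative paths -/

lemma height_snoc_of_le {L : ℕ} (w : Fin L → Bool) (x : Bool) {i : ℕ} (hi : i ≤ L) :
    height (Fin.snoc w x : Fin (L + 1) → Bool) i = height w i := by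
  simp only [height, sum_filter, Fin.sum_univ_castSucc, Fin.snoc_castSucc, Fin.val_castSucc,
    Fin.val_last]
  rw [if_neg (by omega), add_zero]

lemma height_snoc_last {L : ℕ} (w : Fin L → Bool) (x : Bool) :
    height (Fin.snoc w x : Fin (L + 1) → Bool) (L + 1) = height w L + if x then 1 else -1 := by
  simp only [height, sum_filter, Fin.sum_univ_castSucc, Fin.snoc_castSucc, Fin.val_castSucc,
    Fin.val_last, Fin.snoc_last]
  rw [if_pos (Nat.lt_succ_self L)]
  congr 1
  refine sum_congr rfl fun j _ => ?_
  rw [if_pos (j.2.trans (Nat.lt_succ_self L)), if_pos j.2]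

lemma height_length {L : ℕ} (w : Fin L → Bool) :
    height w L = 2 * (#{j | w j = true} : ℤ) - L := by
  have h1 : height w L = ∑ j, (2 * (if w j = true then (1 : ℤ) else 0) - 1) := by
    rw [height, filter_true_of_mem fun j _ => j.2]
    refine sum_congr rfl fun j _ => ?_
    split_ifs <;> simp
  rw [h1, sum_sub_distrib, ← mul_sum, sum_boole]
  simp

lemma area_snoc {L : ℕ} (w : Fin L → Bool) (x : Bool) :
    area (Fin.snoc w x : Fin (L + 1) → Bool) =
      area w + height w L + (if x then 1 else -1) / 2 := by
  rw [area, sum_range_succ, height_snoc_of_le w x le_rfl, height_snoc_last, area]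
  rw [sum_congr rfl fun i hi => by
    rw [height_snoc_of_le w x (mem_range.mp hi).le, height_snoc_of_le w x (mem_range.mp hi)]]
  push_cast
  ring

/-- The weighted sum of `t ^ area w` over all nonnegative paths of length `L` with final
height `h`. -/
def pathWeight (t : ℝ) (L : ℕ) (h : ℤ) : ℝ :=
  ∑ w : Fin L → Bool,
    if (∀ i ≤ L, 0 ≤ height w i) ∧ height w L = h then t ^ area w else 0

lemma M_eq_pathWeight (a b : ℕ) (t : ℝ) : M a b t = pathWeight t (2 * a + b) b := by
  rw [M, pathWeight, DyckSet, sum_filter]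
  refine sum_congr rfl fun w _ => ?_
  congr 1
  rw [height_length, and_comm]
  simp only [eq_iff_iff]
  refine and_congr_right fun _ => ?_
  push_cast
  omega

lemma pathWeight_nonneg {t : ℝ} (ht : 0 < t) (L : ℕ) (h : ℤ) : 0 ≤ pathWeight t L h :=
  sum_nonneg fun w _ => by split_ifs <;> positivity

lemma pathWeight_zero (t : ℝ) (h : ℤ) : pathWeight t 0 h = if h = 0 then 1 else 0 := by
  simp [pathWeight, height, area, @eq_comm ℤ 0]

lemma pathWeight_of_neg (t : ℝ) (L : ℕ) {h : ℤ} (hh : h < 0) : pathWeight t L h = 0 :=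
  sum_eq_zero fun w _ => if_neg fun ⟨h1, h2⟩ => by
    have := h1 L le_rfl
    omega

lemma pathWeight_succ {t : ℝ} (ht : 0 < t) (L : ℕ) {h : ℤ} (hh : 0 ≤ h) :
    pathWeight t (L + 1) h =
      t ^ ((h : ℝ) - 1 / 2) * pathWeight t L (h - 1) +
        t ^ ((h : ℝ) + 1 / 2) * pathWeight t L (h + 1) := by
  have key : ∀ (w : Fin L → Bool) (x : Bool),
      (if (∀ i ≤ L + 1, 0 ≤ height (Fin.snoc w x : Fin (L + 1) → Bool) i) ∧
          height (Fin.snoc w x : Fin (L + 1) → Bool) (L + 1) = h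
        then t ^ area (Fin.snoc w x : Fin (L + 1) → Bool) else 0) =
      t ^ ((h : ℝ) - (if x then 1 else -1) / 2) *
        if (∀ i ≤ L, 0 ≤ height w i) ∧ height w L = h - (if x then 1 else -1)
          then t ^ area w else 0 := by
    intro w x
    have hiff : ((∀ i ≤ L + 1, 0 ≤ height (Fin.snoc w x : Fin (L + 1) → Bool) i) ∧
          height (Fin.snoc w x : Fin (L + 1) → Bool) (L + 1) = h) ↔
        ((∀ i ≤ L, 0 ≤ height w i) ∧ height w L = h - (if x then 1 else -1)) := by
      rw [height_snoc_last]
      constructor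
      · rintro ⟨h1, h2⟩
        refine ⟨fun i hi => ?_, by omega⟩
        rw [← height_snoc_of_le w x hi]
        exact h1 i (by omega)
      · rintro ⟨h1, h2⟩
        refine ⟨fun i hi => ?_, by omega⟩
        rcases Nat.lt_or_ge L i with hlt | hle
        · obtain rfl : i = L + 1 := by omega
          rw [height_snoc_last]
          omega
        · rw [height_snoc_of_le w x hle]
          exact h1 i hle
    simp only [hiff]
    rw [mul_ite, mul_zero]
    refine if_ctx_congr Iff.rfl (fun hc => ?_) fun _ => rfl
    rw [area_snoc, ← Real.rpow_add ht, hc.2]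
    congr 1
    cases x <;> push_cast <;> simp <;> ring
  rw [pathWeight, ← (Fin.snocEquiv fun _ : Fin (L + 1) => Bool).sum_comp, Fintype.sum_prod_type,
    Fintype.sum_bool]
  congr 1
  · refine (sum_congr rfl fun w _ => key w true).trans ?_
    rw [pathWeight, mul_sum]
    simp
  · refine (sum_congr rfl fun w _ => key w false).trans ?_
    rw [pathWeight, mul_sum]
    simp [neg_div, sub_neg_eq_add]

lemma pathWeight_succ_zero {t : ℝ} (ht : 0 < t) (L : ℕ) :
    pathWeight t (L + 1) 0 = t ^ (1 / 2 : ℝ) * pathWeight t L 1 := by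
  rw [pathWeight_succ ht L le_rfl, pathWeight_of_neg t L (by norm_num)]
  simp

lemma pathWeight_succ_succ {t : ℝ} (ht : 0 < t) (L h : ℕ) :
    pathWeight t (L + 1) ((h + 1 : ℕ) : ℤ) =
      t ^ ((h : ℝ) + 1 / 2) * pathWeight t L h +
        t ^ (((h + 1 : ℕ) : ℝ) + 1 / 2) * pathWeight t L ((h + 2 : ℕ) : ℤ) := by
  rw [pathWeight_succ ht L (by positivity)]
  have e1 : ((h + 1 : ℕ) : ℤ) - 1 = h := by push_cast; ring
  have e2 : ((h + 1 : ℕ) : ℤ) + 1 = ((h + 2 : ℕ) : ℤ) := by push_cast; ring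
  have e3 : (((h + 1 : ℕ) : ℤ) : ℝ) - 1 / 2 = (h : ℝ) + 1 / 2 := by push_cast; ring
  rw [e1, e2, e3]
  norm_cast

lemma pathWeight_of_lt {t : ℝ} (ht : 0 < t) (L h : ℕ) (hh : L < h) : pathWeight t L h = 0 := by
  induction L generalizing h with
  | zero => rw [pathWeight_zero, if_neg (by omega)]
  | succ L ih =>
    obtain ⟨h, rfl⟩ := Nat.exists_eq_succ_of_ne_zero (by omega : h ≠ 0)
    rw [Nat.succ_eq_add_one, pathWeight_succ_succ ht, ih h (by omega), ih (h + 2) (by omega)]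
    simp

lemma pathWeight_of_odd {t : ℝ} (ht : 0 < t) (L h : ℕ) (hh : Odd (L + h)) :
    pathWeight t L h = 0 := by
  induction L generalizing h with
  | zero =>
    rw [pathWeight_zero, if_neg]
    rintro h0
    obtain rfl : h = 0 := by omega
    simp at hh
  | succ L ih =>
    rcases h with _ | h
    · rw [Nat.cast_zero, pathWeight_succ_zero ht]
      have := ih 1 hh
      rw [Nat.cast_one] at this
      simp [this]
    · rw [pathWeight_succ_succ ht, ih h (by grind), ih (h + 2) (by grind)]
      simp

/-- The maximal area of a path with `a` down steps and `a + b` up steps. -/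
def maxArea (a b : ℕ) : ℝ := ((a : ℝ) + b) ^ 2 - (b : ℝ) ^ 2 / 2

lemma rpow_maxArea_le_pathWeight {t : ℝ} (ht : 0 < t) (a b : ℕ) :
    t ^ maxArea a b ≤ pathWeight t (2 * a + b) b := by
  induction a generalizing b with
  | zero =>
    induction b with
    | zero => simp [maxArea, pathWeight_zero]
    | succ b ih =>
      rw [mul_zero, zero_add] at ih ⊢
      rw [pathWeight_succ_succ ht]
      have : t ^ maxArea 0 (b + 1) = t ^ ((b : ℝ) + 1 / 2) * t ^ maxArea 0 b := by
        rw [← Real.rpow_add ht]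
        congr 1
        simp only [maxArea]
        push_cast
        ring
      rw [this]
      have := pathWeight_nonneg ht b ((b + 2 : ℕ) : ℤ)
      have : t ^ ((b : ℝ) + 1 / 2) * t ^ maxArea 0 b ≤ t ^ ((b : ℝ) + 1 / 2) * pathWeight t b b := by
        gcongr
      have : 0 ≤ t ^ (((b + 1 : ℕ) : ℝ) + 1 / 2) * pathWeight t b ((b + 2 : ℕ) : ℤ) := by
        positivity
      linarith
  | succ a ih =>
    have e : 2 * (a + 1) + b = (2 * a + (b + 1)) + 1 := by ring
    rw [e, pathWeight_succ ht _ (by positivity)]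
    have h1 : t ^ maxArea (a + 1) b = t ^ ((b : ℝ) + 1 / 2) * t ^ maxArea a (b + 1) := by
      rw [← Real.rpow_add ht]
      congr 1
      simp only [maxArea]
      push_cast
      ring
    have h2 := pathWeight_nonneg ht (2 * a + (b + 1)) ((b : ℤ) - 1)
    have h3 : t ^ ((b : ℝ) + 1 / 2) * t ^ maxArea a (b + 1) ≤
        t ^ ((b : ℝ) + 1 / 2) * pathWeight t (2 * a + (b + 1)) ((b : ℤ) + 1) := by
      gcongr
      simpa using ih (b + 1)
    have h4 : 0 ≤ t ^ ((b : ℝ) - 1 / 2) * pathWeight t (2 * a + (b + 1)) ((b : ℤ) - 1) := by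
      positivity
    rw [h1]
    push_cast
    linarith

lemma pathWeight_le {t : ℝ} (ht : 1 < t) (a b : ℕ) :
    pathWeight t (2 * a + b) b ≤ t ^ maxArea a b * boundedGen (t ^ (-2 : ℝ)) a := by
  have ht0 : 0 < t := by linarith
  have hq0 : 0 < t ^ (-2 : ℝ) := by positivity
  have hq1 : t ^ (-2 : ℝ) < 1 := Real.rpow_lt_one_of_one_lt_of_neg ht (by norm_num)
  induction a generalizing b with
  | zero =>
    induction b with
    | zero => simp [maxArea, pathWeight_zero, boundedGen]
    | succ b ih =>
      rw [mul_zero, zero_add] at ih ⊢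
      rw [pathWeight_succ_succ ht0, pathWeight_of_lt ht0 b (b + 2) (by omega), mul_zero, add_zero]
      have : t ^ maxArea 0 (b + 1) = t ^ ((b : ℝ) + 1 / 2) * t ^ maxArea 0 b := by
        rw [← Real.rpow_add ht0]
        congr 1
        simp only [maxArea]
        push_cast
        ring
      rw [this, mul_assoc]
      gcongr
  | succ a iha =>
    have hdown : ∀ b : ℕ, t ^ ((b : ℝ) + 1 / 2) *
        pathWeight t (2 * a + (b + 1)) ((b + 1 : ℕ) : ℤ) ≤
          t ^ maxArea (a + 1) b * boundedGen (t ^ (-2 : ℝ)) a := by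
      intro b
      have : t ^ maxArea (a + 1) b = t ^ ((b : ℝ) + 1 / 2) * t ^ maxArea a (b + 1) := by
        rw [← Real.rpow_add ht0]
        congr 1
        simp only [maxArea]
        push_cast
        ring
      rw [this, mul_assoc]
      gcongr
      exact iha (b + 1)
    induction b with
    | zero =>
      have e : 2 * (a + 1) + 0 = (2 * a + (0 + 1)) + 1 := by ring
      rw [e, Nat.cast_zero, pathWeight_succ_zero ht0]
      have h1 := hdown 0
      have h2 : boundedGen (t ^ (-2 : ℝ)) a ≤ boundedGen (t ^ (-2 : ℝ)) (a + 1) := by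
        have := boundedGen_pos hq0 hq1 (a + 1)
        have h3 : 0 ≤ (t ^ (-2 : ℝ)) ^ (a + 1) * boundedGen (t ^ (-2 : ℝ)) (a + 1) := by positivity
        linarith [boundedGen_succ hq0 hq1 a]
      have h3 : t ^ maxArea (a + 1) 0 * boundedGen (t ^ (-2 : ℝ)) a ≤
          t ^ maxArea (a + 1) 0 * boundedGen (t ^ (-2 : ℝ)) (a + 1) := by gcongr
      simpa using h1.trans h3
    | succ b ihb =>
      have e : 2 * (a + 1) + (b + 1) = (2 * (a + 1) + b) + 1 := by ring
      rw [e, pathWeight_succ_succ ht0]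
      have h1 := hdown (b + 1)
      have e2 : 2 * a + (b + 1 + 1) = 2 * (a + 1) + b := by ring
      rw [e2] at h1
      have h2 : t ^ ((b : ℝ) + 1 / 2) * pathWeight t (2 * (a + 1) + b) b ≤
          t ^ maxArea (a + 1) (b + 1) *
            ((t ^ (-2 : ℝ)) ^ (a + 1) * boundedGen (t ^ (-2 : ℝ)) (a + 1)) := by
        have : t ^ maxArea (a + 1) (b + 1) * (t ^ (-2 : ℝ)) ^ (a + 1) =
            t ^ ((b : ℝ) + 1 / 2) * t ^ maxArea (a + 1) b := by
          rw [← Real.rpow_mul_natCast ht0.le, ← Real.rpow_add ht0, ← Real.rpow_add ht0]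
          congr 1
          simp only [maxArea]
          push_cast
          ring
        rw [← mul_assoc, this, mul_assoc]
        gcongr
      rw [boundedGen_succ hq0 hq1 a, mul_add (t ^ _), add_comm]
      exact add_le_add h1 h2

lemma pathWeight_inner_succ {t : ℝ} (ht : 0 < t) {i j K : ℕ} (hi : i ≤ K) (hj : j ≤ K) :
    ∑ h ∈ range (K + 1), pathWeight t (i + 1) h * pathWeight t j h =
      ∑ h ∈ range (K + 1), pathWeight t i h * pathWeight t (j + 1) h := by
  have key : ∀ i j : ℕ, i ≤ K →
      ∑ h ∈ range (K + 1), pathWeight t (i + 1) h * pathWeight t j h =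
        ∑ h ∈ range K, t ^ ((h : ℝ) + 1 / 2) *
          (pathWeight t i h * pathWeight t j ((h + 1 : ℕ) : ℤ) +
            pathWeight t i ((h + 1 : ℕ) : ℤ) * pathWeight t j h) := by
    intro i j hi
    have h1 : ∑ h ∈ range (K + 1), t ^ ((h : ℝ) + 1 / 2) *
          (pathWeight t i ((h + 1 : ℕ) : ℤ) * pathWeight t j h) =
        ∑ h ∈ range K, t ^ ((h : ℝ) + 1 / 2) *
          (pathWeight t i ((h + 1 : ℕ) : ℤ) * pathWeight t j h) := by
      rw [sum_range_succ, pathWeight_of_lt ht i (K + 1) (by omega)]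
      simp
    simp_rw [mul_add]
    rw [sum_add_distrib, ← h1, sum_range_succ' _ K, sum_range_succ' _ K, ← add_assoc,
      ← sum_add_distrib]
    congr 1
    · refine sum_congr rfl fun h _ => ?_
      rw [pathWeight_succ_succ ht]
      ring
    · rw [Nat.cast_zero, pathWeight_succ_zero ht]
      simp
      ring
  rw [key i j hi]
  simp_rw [mul_comm (pathWeight t i _) (pathWeight t (j + 1) _)]
  rw [key j i hj]
  exact sum_congr rfl fun h _ => by ring

lemma sum_pathWeight_mul_pathWeight {t : ℝ} (ht : 0 < t) (i j : ℕ) :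
    ∑ h ∈ range (i + j + 1), pathWeight t i h * pathWeight t j h = pathWeight t (i + j) 0 := by
  induction i generalizing j with
  | zero =>
    rw [sum_range_succ', sum_eq_zero]
    · simp [pathWeight_zero]
    · intro h _
      rw [pathWeight_zero, if_neg (by omega), zero_mul]
  | succ i ih =>
    rw [pathWeight_inner_succ ht (by omega) (by omega), ← (by ring : i + (j + 1) = i + 1 + j)]
    exact ih (j + 1)

/-! ### Schmidt coefficients -/

lemma Mlm_eq_pathWeight (t : ℝ) (a b : ℕ) : Mlm (2 * a + b) b t = pathWeight t (2 * a + b) b := by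
  rw [Mlm, M_eq_pathWeight]
  congr 2
  omega

/-- The weight `λ_N` of the ground state with `N` down steps in the left block of `n1` sites. -/
def schmidtWeight (t : ℝ) (n n1 N : ℕ) : ℝ :=
  Mlm n1 (n1 - 2 * N) t * Mlm (2 * n - n1) (n1 - 2 * N) t / Mlm (2 * n) 0 t

lemma schmidtWeight_eq (t : ℝ) {n n1 N : ℕ} (h : n1 ≤ n) (hN : 2 * N ≤ n1) :
    schmidtWeight t n n1 N = pathWeight t n1 ((n1 - 2 * N : ℕ) : ℤ) *
      pathWeight t (2 * n - n1) ((n1 - 2 * N : ℕ) : ℤ) / pathWeight t (2 * n) 0 := by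
  have h1 := Mlm_eq_pathWeight t N (n1 - 2 * N)
  have h2 := Mlm_eq_pathWeight t (n - n1 + N) (n1 - 2 * N)
  have h3 := Mlm_eq_pathWeight t n 0
  rw [(by omega : 2 * N + (n1 - 2 * N) = n1)] at h1
  rw [(by omega : 2 * (n - n1 + N) + (n1 - 2 * N) = 2 * n - n1)] at h2
  rw [add_zero, Nat.cast_zero] at h3
  rw [schmidtWeight, h1, h2, h3]

lemma pathWeight_two_mul_pos {t : ℝ} (ht : 0 < t) (n : ℕ) : 0 < pathWeight t (2 * n) 0 :=
  (Real.rpow_pos_of_pos ht _).trans_le (by simpa using rpow_maxArea_le_pathWeight ht n 0)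

lemma schmidtWeight_pos {t : ℝ} (ht : 0 < t) {n n1 N : ℕ} (h : n1 ≤ n) (hN : 2 * N ≤ n1) :
    0 < schmidtWeight t n n1 N := by
  have h1 := rpow_maxArea_le_pathWeight ht N (n1 - 2 * N)
  have h2 := rpow_maxArea_le_pathWeight ht (n - n1 + N) (n1 - 2 * N)
  rw [(by omega : 2 * N + (n1 - 2 * N) = n1)] at h1
  rw [(by omega : 2 * (n - n1 + N) + (n1 - 2 * N) = 2 * n - n1)] at h2
  rw [schmidtWeight_eq t h hN]
  exact div_pos (mul_pos ((Real.rpow_pos_of_pos ht _).trans_le h1)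
    ((Real.rpow_pos_of_pos ht _).trans_le h2)) (pathWeight_two_mul_pos ht n)

lemma sum_schmidtWeight {t : ℝ} (ht : 0 < t) {n n1 : ℕ} (h : n1 ≤ n) :
    ∑ N ∈ range (n1 / 2 + 1), schmidtWeight t n n1 N = 1 := by
  have hconv := sum_pathWeight_mul_pathWeight ht n1 (2 * n - n1)
  rw [(by omega : n1 + (2 * n - n1) = 2 * n)] at hconv
  have hsum : ∑ N ∈ range (n1 / 2 + 1), pathWeight t n1 ((n1 - 2 * N : ℕ) : ℤ) *
      pathWeight t (2 * n - n1) ((n1 - 2 * N : ℕ) : ℤ) = pathWeight t (2 * n) 0 := by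
    rw [← hconv]
    refine sum_of_injOn (fun N => n1 - 2 * N) ?_ ?_ ?_ fun _ _ => rfl
    · intro a ha b hb hab
      simp only [coe_range, Set.mem_Iio] at ha hb hab
      omega
    · intro a ha
      simp only [coe_range, Set.mem_Iio] at ha ⊢
      omega
    · intro k _ hk
      by_cases hlt : n1 < k
      · rw [pathWeight_of_lt ht n1 k hlt, zero_mul]
      · rw [pathWeight_of_odd ht n1 k, zero_mul]
        by_contra hodd
        rw [Nat.not_odd_iff_even] at hodd
        obtain ⟨c, hc⟩ := hodd
        refine hk ⟨n1 - c, ?_, ?_⟩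
        · simp only [coe_range, Set.mem_Iio]
          omega
        · show n1 - 2 * (n1 - c) = k
          omega
  rw [sum_congr rfl fun N hN => schmidtWeight_eq t h (by have := mem_range.mp hN; omega),
    ← sum_div, hsum, div_self (pathWeight_two_mul_pos ht n).ne']

lemma boundedGen_le_C {t : ℝ} (ht : 1 < t) (a : ℕ) : boundedGen (t ^ (-2 : ℝ)) a ≤ C t := by
  rw [C_eq (by linarith)]
  exact boundedGen_le_tsum (by positivity) (Real.rpow_lt_one_of_one_lt_of_neg ht (by norm_num)) a

lemma C_pos {t : ℝ} (ht : 1 < t) : 0 < C t :=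
  (by simp [boundedGen] : (0 : ℝ) < boundedGen (t ^ (-2 : ℝ)) 0).trans_le (boundedGen_le_C ht 0)

lemma schmidtWeight_le {t : ℝ} (ht : 1 < t) {n n1 N : ℕ} (h : n1 ≤ n) (hN : 2 * N ≤ n1) :
    schmidtWeight t n n1 N ≤ C t ^ 2 * t ^ (-(2 : ℝ) * N ^ 2) := by
  have ht0 : 0 < t := by linarith
  have hC := C_pos ht
  have h1 := (pathWeight_le ht N (n1 - 2 * N)).trans
    (mul_le_mul_of_nonneg_left (boundedGen_le_C ht _) (Real.rpow_nonneg ht0.le _))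
  have h2 := (pathWeight_le ht (n - n1 + N) (n1 - 2 * N)).trans
    (mul_le_mul_of_nonneg_left (boundedGen_le_C ht _) (Real.rpow_nonneg ht0.le _))
  have h3 := rpow_maxArea_le_pathWeight ht0 n 0
  rw [(by omega : 2 * N + (n1 - 2 * N) = n1)] at h1
  rw [(by omega : 2 * (n - n1 + N) + (n1 - 2 * N) = 2 * n - n1)] at h2
  rw [add_zero, Nat.cast_zero] at h3
  rw [schmidtWeight_eq t h hN, div_le_iff₀ (pathWeight_two_mul_pos ht0 n)]
  calc _ ≤ (t ^ maxArea N (n1 - 2 * N) * C t) * (t ^ maxArea (n - n1 + N) (n1 - 2 * N) * C t) :=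
        mul_le_mul h1 h2 (pathWeight_nonneg ht0 _ _) (by positivity)
    _ = C t ^ 2 * t ^ (maxArea N (n1 - 2 * N) + maxArea (n - n1 + N) (n1 - 2 * N)) := by
        rw [Real.rpow_add ht0]
        ring
    _ ≤ C t ^ 2 * t ^ (-(2 : ℝ) * N ^ 2 + maxArea n 0) := by
        have hnn : (n1 : ℝ) ≤ n := by exact_mod_cast h
        have hN0 : (0 : ℝ) ≤ N := Nat.cast_nonneg N
        refine mul_le_mul_of_nonneg_left (Real.rpow_le_rpow_of_exponent_le ht.le ?_) (by positivity)
        simp only [maxArea]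
        push_cast [Nat.cast_sub h, Nat.cast_sub hN]
        nlinarith [mul_nonneg hN0 (sub_nonneg.mpr hnn)]
    _ ≤ _ := by
        rw [Real.rpow_add ht0, ← mul_assoc]
        gcongr

/-! ### Entropy inequalities for finite distributions -/

lemma mul_sum_mul_le_log_sum_mul_exp {ι : Type*} {S : Finset ι} {l : ι → ℝ}
    (hl : ∀ i ∈ S, 0 < l i) (hsum : ∑ i ∈ S, l i = 1) (c : ℝ) (r : ι → ℝ) :
    c * ∑ i ∈ S, l i * r i ≤ Real.log (∑ i ∈ S, l i * Real.exp (c * r i)) := by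
  have h := convexOn_exp.map_sum_le (t := S) (w := l) (p := fun i => c * r i)
    (fun i hi => (hl i hi).le) hsum fun _ _ => Set.mem_univ _
  simp only [smul_eq_mul] at h
  rw [Real.le_log_iff_exp_le ((Real.exp_pos _).trans_le h), mul_sum]
  simpa only [mul_left_comm] using h

lemma sum_mul_log_sub_log_le {ι : Type*} {S : Finset ι} {l q : ι → ℝ}
    (hl : ∀ i ∈ S, 0 < l i) (hsum : ∑ i ∈ S, l i = 1) (hq : ∀ i ∈ S, 0 < q i) :
    ∑ i ∈ S, l i * (Real.log (q i) - Real.log (l i)) ≤ Real.log (∑ i ∈ S, q i) := by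
  have h := mul_sum_mul_le_log_sum_mul_exp hl hsum 1 fun i => Real.log (q i) - Real.log (l i)
  rw [one_mul] at h
  refine h.trans_eq (congrArg _ (sum_congr rfl fun i hi => ?_))
  have := hl i hi
  rw [one_mul, Real.exp_sub, Real.exp_log (hq i hi), Real.exp_log this]
  field_simp

lemma div_mul_log_sum_mul_exp_le {ι : Type*} {S : Finset ι} {l : ι → ℝ}
    (hl : ∀ i ∈ S, 0 < l i) (hsum : ∑ i ∈ S, l i = 1) {c d : ℝ} (hc : 0 < c) (hcd : c ≤ d)
    (r : ι → ℝ) :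
    d / c * Real.log (∑ i ∈ S, l i * Real.exp (c * r i)) ≤
      Real.log (∑ i ∈ S, l i * Real.exp (d * r i)) := by
  have hS : S.Nonempty := nonempty_of_sum_ne_zero (hsum.trans_ne one_ne_zero)
  have hpos : ∀ e : ℝ, 0 < ∑ i ∈ S, l i * Real.exp (e * r i) := fun e =>
    sum_pos (fun i hi => mul_pos (hl i hi) (Real.exp_pos _)) hS
  have h := Real.rpow_arith_mean_le_arith_mean_rpow S l (fun i => Real.exp (c * r i))
    (fun i hi => (hl i hi).le) hsum (fun i _ => (Real.exp_pos _).le) ((one_le_div hc).mpr hcd)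
  rw [← Real.log_rpow (hpos c)]
  refine Real.log_le_log (Real.rpow_pos_of_pos (hpos c) _) (h.trans_eq ?_)
  refine sum_congr rfl fun i _ => ?_
  rw [← Real.exp_mul]
  congr 2
  field_simp

lemma summable_pow_mul_exp_sub_sq (c : ℝ) {d : ℝ} (hd : 0 < d) (k : ℕ) :
    Summable fun N : ℕ => (N : ℝ) ^ k * Real.exp (c * N - d * N ^ 2) := by
  have h := (summable_pow_mul_jacobiTheta₂_term_bound (c / (2 * Real.pi))
    (div_pos hd Real.pi_pos) k).comp_injective Nat.cast_injective
  refine h.congr fun N => ?_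
  simp only [Function.comp, Int.cast_natCast, Nat.abs_cast]
  congr 2
  field_simp
  ring

lemma rpow_mul_rpow_eq_mul_exp {l s : ℝ} (hl : 0 < l) (hs : 0 < s) (κ b : ℝ) :
    s ^ ((1 - κ) * b) * l ^ κ = l * Real.exp ((κ - 1) * (Real.log l - b * Real.log s)) := by
  nth_rewrite 2 [← Real.exp_log hl]
  rw [Real.rpow_def_of_pos hs, Real.rpow_def_of_pos hl, ← Real.exp_add, ← Real.exp_add]
  congr 1
  ring

lemma sum_range_lt_tsum {f : ℕ → ℝ} (hf : Summable f) (hpos : ∀ i, 0 < f i) (K : ℕ) :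
    ∑ i ∈ range K, f i < ∑' i, f i := by
  have h := hf.sum_le_tsum (range (K + 1)) fun i _ => (hpos i).le
  rw [sum_range_succ] at h
  linarith [hpos K]

/-- Bounds on the Rényi entropy of order `κ > 1`:
`n1 log s + (4κ/(1-2κ)) log C(t) + (1/(1-2κ)) log D4(s,t,2κ) < S^κ_{n1}(s,t)
  < n1 log s + D2(t) + D3(t)`. -/
theorem stmt_17 (t κ : ℝ) (ht : 1 < t) (hκ : 1 < κ) (s : ℕ) (hs : 1 ≤ s)
    (n n1 : ℕ) (hn : 1 ≤ n) (hn1 : 1 ≤ n1) (h : n1 ≤ n) :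
    let lam : ℕ → ℝ := fun N' =>
      Mlm n1 (n1 - 2 * N') t * Mlm (2 * n - n1) (n1 - 2 * N') t / Mlm (2 * n) 0 t
    let Sκ := (1 / (1 - κ)) * Real.log (∑ N' ∈ Finset.range (n1 / 2 + 1),
      (s : ℝ) ^ ((1 - κ) * ((n1 - 2 * N' : ℕ) : ℝ)) * lam N' ^ κ)
    let D2 := Real.log (∑' M' : ℕ, t ^ (-(2 : ℝ) * M' ^ 2))
    let D3 := 2 * C t ^ 2 * Real.log t * ∑' N' : ℕ, (N' : ℝ) ^ 2 * t ^ (-(2 : ℝ) * N' ^ 2)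
    let D4 : ℝ → ℝ := fun κ' =>
      ∑' N' : ℕ, (s : ℝ) ^ (-(2 : ℝ) * (1 - κ') * N') * t ^ (-(2 : ℝ) * κ' * N' ^ 2)
    (n1 : ℝ) * Real.log s + (4 * κ / (1 - 2 * κ)) * Real.log (C t)
        + (1 / (1 - 2 * κ)) * Real.log (D4 (2 * κ)) < Sκ ∧
    Sκ < (n1 : ℝ) * Real.log s + D2 + D3 := by
  intro lam Sκ D2 D3 D4
  have ht0 : 0 < t := by linarith
  have hlt : 0 < Real.log t := Real.log_pos ht
  have hs1 : (1 : ℝ) ≤ s := by exact_mod_cast hs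
  have hs0 : (0 : ℝ) < s := by linarith
  have hls : 0 ≤ Real.log s := Real.log_nonneg hs1
  have hC := C_pos ht
  have hle : ∀ N ∈ range (n1 / 2 + 1), 2 * N ≤ n1 := fun N hN => by
    have := mem_range.mp hN
    omega
  have hpos : ∀ N ∈ range (n1 / 2 + 1), 0 < lam N := fun N hN =>
    schmidtWeight_pos ht0 h (hle N hN)
  have hbound : ∀ N ∈ range (n1 / 2 + 1), lam N ≤ C t ^ 2 * t ^ (-(2 : ℝ) * N ^ 2) :=
    fun N hN => schmidtWeight_le ht h (hle N hN)
  have hsum : ∑ N ∈ range (n1 / 2 + 1), lam N = 1 := sum_schmidtWeight ht0 h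
  clear_value lam
  set r : ℕ → ℝ := fun N => Real.log (lam N) - ((n1 - 2 * N : ℕ) : ℝ) * Real.log s with hr
  have hT : ∀ κ' : ℝ, ∑ N ∈ range (n1 / 2 + 1),
      (s : ℝ) ^ ((1 - κ') * ((n1 - 2 * N : ℕ) : ℝ)) * lam N ^ κ' =
        ∑ N ∈ range (n1 / 2 + 1), lam N * Real.exp ((κ' - 1) * r N) := fun κ' =>
    sum_congr rfl fun N hN => rpow_mul_rpow_eq_mul_exp (hpos N hN) hs0 κ' _
  have hSκ : Sκ = -(Real.log (∑ N ∈ range (n1 / 2 + 1), lam N * Real.exp ((κ - 1) * r N)) /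
      (κ - 1)) := by
    simp only [Sκ]
    rw [hT, ← neg_sub κ 1, one_div, inv_neg, neg_mul, div_eq_inv_mul]
  have hκ1 : 0 < κ - 1 := by linarith
  have hκ2 : 0 < 2 * κ - 1 := by linarith
  rw [hSκ]
  constructor
  · have hterm : ∀ N : ℕ, (s : ℝ) ^ (-(2 : ℝ) * (1 - 2 * κ) * N) * t ^ (-(2 : ℝ) * (2 * κ) * N ^ 2)
        = (N : ℝ) ^ 0 * Real.exp (2 * (2 * κ - 1) * Real.log s * N -
          4 * κ * Real.log t * N ^ 2) := by
      intro N
      rw [Real.rpow_def_of_pos hs0, Real.rpow_def_of_pos ht0, ← Real.exp_add, pow_zero, one_mul]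
      congr 1
      ring
    have hsummable : Summable fun N : ℕ =>
        (s : ℝ) ^ (-(2 : ℝ) * (1 - 2 * κ) * N) * t ^ (-(2 : ℝ) * (2 * κ) * N ^ 2) := by
      simp_rw [hterm]
      exact summable_pow_mul_exp_sub_sq _ (by positivity) 0
    have hD4 : ∑ N ∈ range (n1 / 2 + 1),
        (s : ℝ) ^ (-(2 : ℝ) * (1 - 2 * κ) * N) * t ^ (-(2 : ℝ) * (2 * κ) * N ^ 2) < D4 (2 * κ) :=
      sum_range_lt_tsum hsummable (fun N => by positivity) _
    have hD4pos : 0 < D4 (2 * κ) := (sum_nonneg fun N _ => by positivity).trans_lt hD4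
    have hmono := div_mul_log_sum_mul_exp_le hpos hsum hκ1
      (by linarith : κ - 1 ≤ 2 * κ - 1) r
    have hA : (0 : ℝ) < s ^ ((1 - 2 * κ) * n1) := by positivity
    have hB : 0 < C t ^ (4 * κ) := by positivity
    have hlt2 : ∑ N ∈ range (n1 / 2 + 1), lam N * Real.exp ((2 * κ - 1) * r N) <
        (s : ℝ) ^ ((1 - 2 * κ) * n1) * C t ^ (4 * κ) * D4 (2 * κ) := by
      refine lt_of_le_of_lt ?_ (mul_lt_mul_of_pos_left hD4 (mul_pos hA hB))
      rw [← hT, mul_sum]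
      refine sum_le_sum fun N hN => ?_
      have h1 : lam N ^ (2 * κ) ≤ C t ^ (4 * κ) * t ^ (-(2 : ℝ) * (2 * κ) * N ^ 2) := by
        refine (Real.rpow_le_rpow (hpos N hN).le (hbound N hN) (by linarith)).trans_eq ?_
        rw [Real.mul_rpow (by positivity) (by positivity), ← Real.rpow_natCast_mul hC.le,
          ← Real.rpow_mul ht0.le]
        congr 2 <;> push_cast <;> ring
      have h2 : (s : ℝ) ^ ((1 - 2 * κ) * ((n1 - 2 * N : ℕ) : ℝ)) =
          s ^ ((1 - 2 * κ) * n1) * s ^ (-(2 : ℝ) * (1 - 2 * κ) * N) := by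
        rw [← Real.rpow_add hs0, Nat.cast_sub (hle N hN)]
        congr 1
        push_cast
        ring
      rw [h2]
      calc _ ≤ (s : ℝ) ^ ((1 - 2 * κ) * n1) * s ^ (-(2 : ℝ) * (1 - 2 * κ) * N) *
            (C t ^ (4 * κ) * t ^ (-(2 : ℝ) * (2 * κ) * N ^ 2)) := by gcongr
        _ = _ := by ring
    have hTpos : 0 < ∑ N ∈ range (n1 / 2 + 1), lam N * Real.exp ((2 * κ - 1) * r N) :=
      sum_pos (fun N hN => mul_pos (hpos N hN) (Real.exp_pos _)) (by simp)
    have hlog := Real.log_lt_log hTpos hlt2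
    rw [Real.log_mul (mul_pos hA hB).ne' hD4pos.ne', Real.log_mul hA.ne' hB.ne',
      Real.log_rpow hs0, Real.log_rpow hC] at hlog
    have hfin := hmono.trans_lt hlog
    rw [div_mul_eq_mul_div, mul_div_assoc] at hfin
    have hne : 1 - 2 * κ ≠ 0 := by linarith
    have e : (n1 : ℝ) * Real.log s + (4 * κ / (1 - 2 * κ)) * Real.log (C t)
        + (1 / (1 - 2 * κ)) * Real.log (D4 (2 * κ)) =
        -(((1 - 2 * κ) * n1 * Real.log s + 4 * κ * Real.log (C t) + Real.log (D4 (2 * κ))) /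
          (2 * κ - 1)) := by
      rw [← neg_sub 1 (2 * κ), div_neg, neg_neg, add_div, add_div, mul_assoc,
        mul_div_cancel_left₀ _ hne]
      ring
    rw [e]
    refine neg_lt_neg ?_
    rw [lt_div_iff₀ hκ2, mul_comm]
    exact hfin
  · have hjensen := mul_sum_mul_le_log_sum_mul_exp hpos hsum (κ - 1) r
    have hgibbs := sum_mul_log_sub_log_le (q := fun N : ℕ => t ^ (-(2 : ℝ) * N ^ 2)) hpos hsum
      fun N _ => by positivity
    have hterm : ∀ (k N : ℕ), (N : ℝ) ^ k * t ^ (-(2 : ℝ) * N ^ 2) =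
        (N : ℝ) ^ k * Real.exp (0 * N - 2 * Real.log t * N ^ 2) := by
      intro k N
      rw [Real.rpow_def_of_pos ht0]
      congr 2
      ring
    have hsummable : ∀ k : ℕ, Summable fun N : ℕ => (N : ℝ) ^ k * t ^ (-(2 : ℝ) * N ^ 2) := by
      intro k
      simp_rw [hterm]
      exact summable_pow_mul_exp_sub_sq _ (by positivity) k
    have hZ : Real.log (∑ N ∈ range (n1 / 2 + 1), t ^ (-(2 : ℝ) * (N : ℝ) ^ 2)) < D2 :=
      Real.log_lt_log (sum_pos (fun N _ => by positivity) (by simp))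
        (sum_range_lt_tsum (by simpa using hsummable 0) (fun N => by positivity) _)
    have hvar : ∑ N ∈ range (n1 / 2 + 1), lam N * (2 * (N : ℝ) ^ 2 * Real.log t) ≤ D3 := by
      calc _ ≤ ∑ N ∈ range (n1 / 2 + 1),
            (C t ^ 2 * t ^ (-(2 : ℝ) * N ^ 2)) * (2 * (N : ℝ) ^ 2 * Real.log t) :=
            sum_le_sum fun N hN => mul_le_mul_of_nonneg_right (hbound N hN) (by positivity)
        _ = 2 * C t ^ 2 * Real.log t *
            ∑ N ∈ range (n1 / 2 + 1), (N : ℝ) ^ 2 * t ^ (-(2 : ℝ) * N ^ 2) := by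
            rw [mul_sum]
            exact sum_congr rfl fun N _ => by ring
        _ ≤ D3 := mul_le_mul_of_nonneg_left
            ((hsummable 2).sum_le_tsum _ fun N _ => by positivity) (by positivity)
    have hcolor : ∑ N ∈ range (n1 / 2 + 1), lam N * (((n1 - 2 * N : ℕ) : ℝ) * Real.log s) ≤
        n1 * Real.log s := by
      calc _ ≤ ∑ N ∈ range (n1 / 2 + 1), lam N * (n1 * Real.log s) := by
            refine sum_le_sum fun N hN => mul_le_mul_of_nonneg_left ?_ (hpos N hN).le
            gcongr
            exact Nat.sub_le _ _
        _ = _ := by rw [← sum_mul, hsum, one_mul]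
    have hsplit : -∑ N ∈ range (n1 / 2 + 1), lam N * r N =
        ∑ N ∈ range (n1 / 2 + 1), lam N * (((n1 - 2 * N : ℕ) : ℝ) * Real.log s) +
        ∑ N ∈ range (n1 / 2 + 1),
          lam N * (Real.log (t ^ (-(2 : ℝ) * (N : ℝ) ^ 2)) - Real.log (lam N)) +
        ∑ N ∈ range (n1 / 2 + 1), lam N * (2 * (N : ℝ) ^ 2 * Real.log t) := by
      rw [← sum_add_distrib, ← sum_add_distrib, ← sum_neg_distrib]
      refine sum_congr rfl fun N _ => ?_
      rw [Real.log_rpow ht0]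
      simp only [hr]
      ring
    have hS : -(Real.log (∑ N ∈ range (n1 / 2 + 1), lam N * Real.exp ((κ - 1) * r N)) / (κ - 1)) ≤
        -∑ N ∈ range (n1 / 2 + 1), lam N * r N := by
      refine neg_le_neg ?_
      rw [le_div_iff₀ hκ1, mul_comm]
      exact hjensen
    linarith
end
end

section
/- Let t > 1 be a real number, s ≥ 1 an integer, let n ≥ 1 and 1 ≤ n1 ≤ n be integers, and let N' be a natural number with 2N' ≤ n1. Define the entanglement energy E_{n1,N'} := −log[ s^{2N'−n1} · M_{n1,n1−2N'}(t) · M_{2n−n1,n1−2N'}(t) / M_{2n,0}(t) ]. Then (2N'² + 2N'(n−n1)) log t + (n1−2N') log s − 2 log C(t) < E_{n1,N'} < (2N'² + 2N'(n−n1)) log t + (n1−2N') log s + log C(t). -/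
noncomputable section

open Finset

/-- The parts of the partition cut out between a path and the maximal path with the same number
of up and down steps: every down step contributes the number of up steps after it, if positive. -/
def inversionParts : List Bool → Multiset ℕ
  | [] => 0
  | true :: l => inversionParts l
  | false :: l =>
    if l.count true = 0 then inversionParts l else l.count true ::ₘ inversionParts l

theorem pos_of_mem_inversionParts {l : List Bool} {i : ℕ} (hi : i ∈ inversionParts l) :
    0 < i := by
  induction l with
  | nil => simp [inversionParts] at hi
  | cons x l ih =>
    cases x <;> simp only [inversionParts] at hi
    · split_ifs at hi with h
      · exact ih hi
      · rcases Multiset.mem_cons.1 hi with rfl | hi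
        · omega
        · exact ih hi
    · exact ih hi

theorem le_count_of_mem_inversionParts {l : List Bool} {i : ℕ} (hi : i ∈ inversionParts l) :
    i ≤ l.count true := by
  induction l with
  | nil => simp [inversionParts] at hi
  | cons x l ih =>
    cases x <;> simp only [inversionParts] at hi
    · rw [List.count_cons_of_ne (by simp)]
      split_ifs at hi with h
      · exact ih hi
      · rcases Multiset.mem_cons.1 hi with rfl | hi
        · exact le_rfl
        · exact ih hi
    · rw [List.count_cons_self]
      exact (ih hi).trans (Nat.le_succ _)

theorem inversionParts_true_cons_ne {l l' : List Bool}
    (hc : (true :: l).count true = (false :: l').count true) :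
    inversionParts (true :: l) ≠ inversionParts (false :: l') := by
  intro he
  rw [List.count_cons_self, List.count_cons_of_ne (by simp)] at hc
  simp only [inversionParts] at he
  rw [if_neg (by omega), ← hc] at he
  have hmem : l.count true + 1 ∈ inversionParts l := he ▸ Multiset.mem_cons_self _ _
  have := le_count_of_mem_inversionParts hmem
  omega

theorem inversionParts_injective {l l' : List Bool} (hl : l.length = l'.length)
    (hc : l.count true = l'.count true) (he : inversionParts l = inversionParts l') :
    l = l' := by
  induction l generalizing l' with
  | nil => exact (List.length_eq_zero_iff.1 hl.symm).symm
  | cons x l ih =>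
    cases l' with
    | nil => simp at hl
    | cons y l' =>
      cases x <;> cases y
      · simp only [List.length_cons, Nat.add_right_cancel_iff] at hl
        rw [List.count_cons_of_ne (by simp), List.count_cons_of_ne (by simp)] at hc
        simp only [inversionParts, ← hc] at he
        split_ifs at he with h
        · rw [ih hl hc he]
        · rw [ih hl hc ((Multiset.cons_inj_right _).1 he)]
      · exact absurd he.symm (inversionParts_true_cons_ne hc.symm)
      · exact absurd he (inversionParts_true_cons_ne hc)
      · simp only [List.length_cons, Nat.add_right_cancel_iff] at hl
        rw [List.count_cons_self, List.count_cons_self, Nat.add_right_cancel_iff] at hc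
        rw [ih hl hc he]

theorem sum_inversionParts_false_cons (l : List Bool) :
    (inversionParts (false :: l)).sum = l.count true + (inversionParts l).sum := by
  simp only [inversionParts]
  split_ifs with h <;> simp [h]

theorem inversionParts_replicate_append (p d : ℕ) :
    inversionParts (List.replicate p true ++ List.replicate d false) = 0 := by
  induction p with
  | zero =>
    induction d with
    | zero => rfl
    | succ d ih =>
      simp only [List.replicate_zero, List.nil_append, List.replicate_succ] at ih ⊢
      simp [inversionParts, ih, List.count_replicate]
  | succ p ih => simpa [List.replicate_succ, inversionParts] using ih

theorem card_filter_eq_count_ofFn {L : ℕ} (w : Fin L → Bool) :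
    (univ.filter (fun j => w j = true)).card = (List.ofFn w).count true := by
  induction L with
  | zero => simp
  | succ L ih =>
    rw [List.ofFn_succ, List.count_cons, ← ih, card_filter, card_filter, Fin.sum_univ_succ]
    simp [add_comm]

theorem height_zero {L : ℕ} (w : Fin L → Bool) : height w 0 = 0 := by
  simp [height]

theorem height_succ {L : ℕ} (w : Fin (L + 1) → Bool) (i : ℕ) :
    height w (i + 1) = (if w 0 then 1 else -1) + height (fun j => w j.succ) i := by
  simp only [height, sum_filter, Fin.sum_univ_succ]
  simp

theorem area_succ {L : ℕ} (w : Fin (L + 1) → Bool) :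
    area w = (L + 1 / 2) * (if w 0 then 1 else -1) + area (fun j => w j.succ) := by
  simp only [area, sum_range_succ', height_succ, height_zero]
  push_cast
  simp only [sum_add_distrib, sum_const, card_range, nsmul_eq_mul]
  ring

theorem area_eq {L : ℕ} (w : Fin L → Bool) :
    area w = L * (List.ofFn w).count true - (L - (List.ofFn w).count true : ℝ) ^ 2 / 2
      - ((List.ofFn w).count true : ℝ) ^ 2 / 2 - 2 * (inversionParts (List.ofFn w)).sum := by
  induction L with
  | zero => simp [area, inversionParts]
  | succ L ih =>
    rw [area_succ, ih, List.ofFn_succ]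
    cases h : w 0
    · rw [sum_inversionParts_false_cons, List.count_cons_of_ne (by simp)]
      simp
      ring
    · rw [List.count_cons_self]
      simp [inversionParts]
      ring

theorem area_of_mem_dyckSet {a b : ℕ} {w : Fin (2 * a + b) → Bool} (hw : w ∈ DyckSet a b) :
    area w = (a + b : ℝ) ^ 2 - (b : ℝ) ^ 2 / 2 - 2 * (inversionParts (List.ofFn w)).sum := by
  have hc := (mem_filter.1 hw).2.1
  rw [card_filter_eq_count_ofFn] at hc
  rw [area_eq, hc]
  push_cast
  ring

/-- The path consisting of `a + b` up steps followed by `a` down steps. -/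
def maxPath (a b : ℕ) : Fin (2 * a + b) → Bool := fun j => decide ((j : ℕ) < a + b)

theorem ofFn_maxPath (a b : ℕ) :
    List.ofFn (maxPath a b) = List.replicate (a + b) true ++ List.replicate a false := by
  apply List.ext_getElem
  · simp; omega
  · intro i h₁ h₂
    simp [maxPath, List.getElem_append]

theorem height_maxPath {a b i : ℕ} (hi : i ≤ 2 * a + b) :
    height (maxPath a b) i = if i ≤ a + b then (i : ℤ) else 2 * (a + b) - i := by
  induction i with
  | zero => simp [height_zero]
  | succ i ih =>
    have hstep : height (maxPath a b) (i + 1) =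
        height (maxPath a b) i + if i < a + b then 1 else -1 := by
      have : univ.filter (fun j : Fin (2 * a + b) => (j : ℕ) < i + 1) =
          insert ⟨i, hi⟩ (univ.filter (fun j : Fin (2 * a + b) => (j : ℕ) < i)) := by
        ext j
        simp [Fin.ext_iff]
        omega
      rw [height, this, sum_insert (by simp), add_comm]
      simp [height, maxPath]
    rw [hstep, ih (by omega)]
    split_ifs <;> push_cast <;> omega

theorem maxPath_mem_dyckSet (a b : ℕ) : maxPath a b ∈ DyckSet a b := by
  refine mem_filter.2 ⟨mem_univ _, ?_, fun i hi => ?_⟩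
  · rw [card_filter_eq_count_ofFn, ofFn_maxPath]
    simp [List.count_replicate]
  · rw [height_maxPath hi]
    split_ifs <;> omega

theorem area_maxPath (a b : ℕ) :
    area (maxPath a b) = (a + b : ℝ) ^ 2 - (b : ℝ) ^ 2 / 2 := by
  rw [area_of_mem_dyckSet (maxPath_mem_dyckSet a b), ofFn_maxPath,
    inversionParts_replicate_append]
  simp

theorem rpow_le_M (a b : ℕ) {t : ℝ} (ht : 0 < t) :
    t ^ ((a + b : ℝ) ^ 2 - (b : ℝ) ^ 2 / 2) ≤ M a b t := by
  rw [← area_maxPath]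
  exact single_le_sum (f := fun w => t ^ area w) (fun _ _ => (Real.rpow_pos_of_pos ht _).le)
    (maxPath_mem_dyckSet a b)

theorem injective_image_count :
    Function.Injective (fun x : Σ k, Nat.Partition k =>
      x.2.parts.toFinset.image (fun i => (i, x.2.parts.count i))) := by
  have key : ∀ {m m' : Multiset ℕ}, m.toFinset.image (fun i => (i, m.count i)) =
      m'.toFinset.image (fun i => (i, m'.count i)) → m ≤ m' := by
    intro m m' he
    refine Multiset.le_iff_count.2 fun i => ?_
    by_cases hi : i ∈ m
    · have : (i, m.count i) ∈ m'.toFinset.image (fun i => (i, m'.count i)) :=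
        he ▸ mem_image_of_mem (fun i => (i, m.count i)) (Multiset.mem_toFinset.2 hi)
      obtain ⟨j, -, hj⟩ := mem_image.1 this
      simp only [Prod.mk.injEq] at hj
      obtain ⟨rfl, hj⟩ := hj
      exact hj.ge
    · simp [Multiset.count_eq_zero_of_notMem hi]
  rintro ⟨k, x⟩ ⟨k', y⟩ he
  have hparts : x.parts = y.parts := le_antisymm (key he) (key he.symm)
  obtain rfl : k = k' := by rw [← x.parts_sum, ← y.parts_sum, hparts]
  rw [Nat.Partition.ext hparts]

theorem summable_pow_partition {q : ℝ} (hq : 0 ≤ q) (hq' : q < 1) :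
    Summable (fun x : Σ k, Nat.Partition k => q ^ x.1) := by
  set r := √q with hr
  have hr0 : 0 ≤ r := Real.sqrt_nonneg q
  have hr1 : r < 1 := (Real.sqrt_lt' one_pos).2 (by simpa using hq')
  have hgeom := summable_geometric_of_lt_one hr0 hr1
  have hpair : Summable (fun x : ℕ × ℕ => r ^ x.1 * r ^ x.2) :=
    hgeom.mul_of_nonneg hgeom (fun _ => pow_nonneg hr0 _) (fun _ => pow_nonneg hr0 _)
  have hprod := (summable_finsetProd_of_summable_nonneg
    (fun x => mul_nonneg (pow_nonneg hr0 _) (pow_nonneg hr0 _)) hpair).comp_injective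
      injective_image_count
  refine hprod.of_nonneg_of_le (fun _ => pow_nonneg hq _) ?_
  rintro ⟨k, x⟩
  dsimp only [Function.comp]
  have hk : q ^ k = q ^ x.parts.sum := by rw [x.parts_sum]
  rw [prod_image (by simp), hk, sum_multiset_count, ← prod_pow_eq_pow_sum]
  refine prod_le_prod (fun _ _ => pow_nonneg hq _) fun i hi => ?_
  have hi := Multiset.mem_toFinset.1 hi
  have h₁ := x.parts_pos hi
  have h₂ := Multiset.count_pos.2 hi
  rw [← Real.sq_sqrt hq, ← hr, ← pow_mul, ← pow_add, smul_eq_mul]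
  refine pow_le_pow_of_le_one hr0 hr1.le ?_
  nlinarith

theorem C_eq_tsum {t : ℝ} (ht : 1 < t) :
    C t = ∑' x : Σ k, Nat.Partition k, (t ^ (-2 : ℝ)) ^ x.1 := by
  have hq : 0 ≤ t ^ (-2 : ℝ) := Real.rpow_nonneg (by linarith) _
  have hq' : t ^ (-2 : ℝ) < 1 := Real.rpow_lt_one_of_one_lt_of_neg ht (by norm_num)
  rw [(summable_pow_partition hq hq').tsum_sigma]
  simp only [C, P, Real.rpow_mul_natCast (by linarith : 0 ≤ t), tsum_fintype, sum_const, card_univ,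
    nsmul_eq_mul]

theorem sum_lt_C {ι : Type*} {s : Finset ι} (f : ι → Σ k, Nat.Partition k)
    (hf : Set.InjOn f s) {t : ℝ} (ht : 1 < t) :
    ∑ i ∈ s, (t ^ (-2 : ℝ)) ^ (f i).1 < C t := by
  classical
  have hq : 0 < t ^ (-2 : ℝ) := Real.rpow_pos_of_pos (by linarith) _
  have hq' : t ^ (-2 : ℝ) < 1 := Real.rpow_lt_one_of_one_lt_of_neg ht (by norm_num)
  have : Infinite (Σ k, Nat.Partition k) :=
    Infinite.of_injective (fun k => ⟨k, Nat.Partition.indiscrete k⟩)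
      (fun _ _ h => congrArg Sigma.fst h)
  obtain ⟨x, hx⟩ := Infinite.exists_notMem_finset (s.image f)
  rw [C_eq_tsum ht, ← sum_image (f := fun x => (t ^ (-2 : ℝ)) ^ x.1) hf]
  refine lt_of_lt_of_le ?_ ((summable_pow_partition hq.le hq').sum_le_tsum (insert x (s.image f))
    (fun _ _ => pow_nonneg hq.le _))
  rw [sum_insert hx]
  exact lt_add_of_pos_left _ (pow_pos hq _)

/-- The partition cut out between a path and the maximal path. -/
def inversionPartition {L : ℕ} (w : Fin L → Bool) : Σ k, Nat.Partition k :=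
  ⟨_, ⟨inversionParts (List.ofFn w), pos_of_mem_inversionParts, rfl⟩⟩

theorem injOn_inversionPartition (a b : ℕ) :
    Set.InjOn (inversionPartition (L := 2 * a + b)) (DyckSet a b) := by
  intro w hw w' hw' he
  have hc := (mem_filter.1 hw).2.1
  have hc' := (mem_filter.1 hw').2.1
  rw [card_filter_eq_count_ofFn] at hc hc'
  have hparts : inversionParts (List.ofFn w) = inversionParts (List.ofFn w') :=
    congrArg (fun x : Σ k, Nat.Partition k => x.2.parts) he
  exact List.ofFn_injective (inversionParts_injective (by simp) (hc.trans hc'.symm) hparts)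

theorem M_lt (a b : ℕ) {t : ℝ} (ht : 1 < t) :
    M a b t < t ^ ((a + b : ℝ) ^ 2 - (b : ℝ) ^ 2 / 2) * C t := by
  have ht0 : 0 < t := by linarith
  have hM : M a b t = t ^ ((a + b : ℝ) ^ 2 - (b : ℝ) ^ 2 / 2) *
      ∑ w ∈ DyckSet a b, (t ^ (-2 : ℝ)) ^ (inversionPartition w).1 := by
    rw [M, mul_sum]
    refine sum_congr rfl fun w hw => ?_
    rw [area_of_mem_dyckSet hw, ← Real.rpow_mul_natCast ht0.le, ← Real.rpow_add ht0]
    congr 1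
    simp only [inversionPartition]
    ring
  rw [hM]
  exact mul_lt_mul_of_pos_left (sum_lt_C _ (injOn_inversionPartition a b) ht)
    (Real.rpow_pos_of_pos ht0 _)

theorem M_pos (a b : ℕ) {t : ℝ} (ht : 0 < t) : 0 < M a b t :=
  (Real.rpow_pos_of_pos ht _).trans_le (rpow_le_M a b ht)

theorem le_log_M (a b : ℕ) {t : ℝ} (ht : 0 < t) :
    ((a + b : ℝ) ^ 2 - (b : ℝ) ^ 2 / 2) * Real.log t ≤ Real.log (M a b t) := by
  rw [← Real.log_rpow ht]
  exact Real.log_le_log (Real.rpow_pos_of_pos ht _) (rpow_le_M a b ht)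

theorem log_M_lt (a b : ℕ) {t : ℝ} (ht : 1 < t) :
    Real.log (M a b t) < ((a + b : ℝ) ^ 2 - (b : ℝ) ^ 2 / 2) * Real.log t + Real.log (C t) := by
  have ht0 : 0 < t := by linarith
  have hlt := M_lt a b ht
  have hC : 0 < C t := pos_of_mul_pos_right ((M_pos a b ht0).trans hlt)
    (Real.rpow_pos_of_pos ht0 _).le
  rw [← Real.log_rpow ht0, ← Real.log_mul (Real.rpow_pos_of_pos ht0 _).ne' hC.ne']
  exact Real.log_lt_log (M_pos a b ht0) hlt

/-- Bounds on the entanglement spectrum: the entanglement energy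
`E_{n1,N'} = -log p_{n1,n1-2N'}(s,t)` satisfies
`(2N'² + 2N'(n-n1)) log t + (n1-2N') log s - 2 log C(t) < E_{n1,N'}
  < (2N'² + 2N'(n-n1)) log t + (n1-2N') log s + log C(t)`. -/
theorem stmt_18 (t : ℝ) (ht : 1 < t) (s : ℕ) (hs : 1 ≤ s) (n n1 N' : ℕ)
    (hn : 1 ≤ n) (hn1 : 1 ≤ n1) (h : n1 ≤ n) (hN : 2 * N' ≤ n1) :
    let E := -Real.log ((s : ℝ) ^ (2 * (N' : ℝ) - n1) *
      Mlm n1 (n1 - 2 * N') t * Mlm (2 * n - n1) (n1 - 2 * N') t / Mlm (2 * n) 0 t)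
    ((2 * N' ^ 2 + 2 * N' * (n - n1) : ℕ) : ℝ) * Real.log t
        + ((n1 - 2 * N' : ℕ) : ℝ) * Real.log s - 2 * Real.log (C t) < E ∧
    E < ((2 * N' ^ 2 + 2 * N' * (n - n1) : ℕ) : ℝ) * Real.log t
        + ((n1 - 2 * N' : ℕ) : ℝ) * Real.log s + Real.log (C t) := by
  obtain ⟨d, rfl⟩ := Nat.exists_eq_add_of_le h
  obtain ⟨m, rfl⟩ := Nat.exists_eq_add_of_le hN
  have hb : 2 * N' + m - 2 * N' = m := by omega
  have hd : 2 * N' + m + d - (2 * N' + m) = d := by omega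
  have h₁ : Mlm (2 * N' + m) m t = M N' m t := by
    rw [Mlm, show (2 * N' + m - m) / 2 = N' by omega]
  have h₂ : Mlm (2 * (2 * N' + m + d) - (2 * N' + m)) m t = M (N' + d) m t := by
    rw [Mlm, show (2 * (2 * N' + m + d) - (2 * N' + m) - m) / 2 = N' + d by omega]
  have h₀ : Mlm (2 * (2 * N' + m + d)) 0 t = M (2 * N' + m + d) 0 t := by
    rw [Mlm, show (2 * (2 * N' + m + d) - 0) / 2 = 2 * N' + m + d by omega]
  have ht0 : 0 < t := by linarith
  have hs0 : (0 : ℝ) < s := by exact_mod_cast hs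
  have hE : ∀ x y z : ℝ, 0 < x → 0 < y → 0 < z →
      Real.log ((s : ℝ) ^ (2 * (N' : ℝ) - (2 * N' + m : ℕ)) * x * y / z) =
        -(m * Real.log s) + Real.log x + Real.log y - Real.log z := by
    intro x y z hx hy hz
    have hsp := Real.rpow_pos_of_pos hs0 (2 * (N' : ℝ) - (2 * N' + m : ℕ))
    rw [Real.log_div (by positivity) hz.ne', Real.log_mul (by positivity) hy.ne',
      Real.log_mul hsp.ne' hx.ne', Real.log_rpow hs0]
    push_cast
    ring
  simp only [hb, hd, h₀, h₁, h₂]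
  rw [hE _ _ _ (M_pos _ _ ht0) (M_pos _ _ ht0) (M_pos _ _ ht0)]
  have l₀ := le_log_M (2 * N' + m + d) 0 ht0
  have l₁ := le_log_M N' m ht0
  have l₂ := le_log_M (N' + d) m ht0
  have u₀ := log_M_lt (2 * N' + m + d) 0 ht
  have u₁ := log_M_lt N' m ht
  have u₂ := log_M_lt (N' + d) m ht
  push_cast at l₀ l₁ l₂ u₀ u₁ u₂ ⊢
  constructor <;> ring_nf at * <;> linarith
end
end
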